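/- For every real x ≥ 1, Σ_{N squarefull, N > x} 1/N ≤ 2η/√x, where the sum is over squarefull integers N > x and η = ζ(3/2)/ζ(3), ζ being the Riemann zeta function. -/

import Mathlib

noncomputable section

/-- Value at `N` of the multiplicative function determined by local values `f p e`
on prime powers `p^e` (`e ≥ 1`). -/
def mval (f : ℕ → ℕ → ℝ) (N : ℕ) : ℝ := ∏ p ∈ N.primeFactors, f p (N.factorization p)

def psiFull : ℕ → ℝ := mval fun p e => (p:ℝ)^e + (p:ℝ)^(e-1)

def nuInfFull : ℕ → ℝ := mval fun p e =>
  if Odd e then 2*(p:ℝ)^((e-1)/2) else (p:ℝ)^(e/2) + (p:ℝ)^(e/2-1)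

def nu2Full : ℕ → ℝ := mval fun p e =>
  if p^e = 2 then 1 else if p % 4 = 1 then 2 else 0

def nu3Full : ℕ → ℝ := mval fun p e =>
  if p^e = 3 then 1 else if p % 3 = 1 then 2 else 0

def psiNew : ℕ → ℝ := mval fun p e =>
  if e = 1 then (p:ℝ)-1
  else if e = 2 then (p:ℝ)^2-(p:ℝ)-1
  else (p:ℝ)^(e-3)*((p:ℝ)-1)^2*((p:ℝ)+1)

def nuInfNew : ℕ → ℝ := mval fun p e =>
  if e = 2 then (p:ℝ)-2
  else if Even e ∧ 2 < e then (p:ℝ)^(e/2-2)*((p:ℝ)-1)^2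
  else 0

def nu2New : ℕ → ℝ := mval fun p e =>
  if p % 4 = 3 ∧ e = 1 then -2
  else if (p % 4 = 3 ∧ e = 2) ∨ p^e = 8 then 1
  else if (p % 4 = 1 ∧ e = 2) ∨ p^e = 2 ∨ p^e = 4 then -1
  else 0

def nu3New : ℕ → ℝ := mval fun p e =>
  if p % 3 = 2 ∧ e = 1 then -2
  else if (p % 3 = 2 ∧ e = 2) ∨ p^e = 27 then 1
  else if (p % 3 = 1 ∧ e = 2) ∨ p^e = 3 ∨ p^e = 9 then -1
  else 0

def psiMin : ℕ → ℝ := mval fun p e =>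
  ((p:ℝ)-1)/((Nat.gcd (Nat.gcd 2 (p-1)) e : ℕ) : ℝ)
    * (if e = 1 then 1 else if e = 2 then (p:ℝ)-1 else (p:ℝ)^(e-3)*((p:ℝ)^2-1))

def nuInfMin : ℕ → ℝ := mval fun p e =>
  if p = 2 ∧ Even e ∧ 2 < e then (2:ℝ)^(e/2-2) else 0

def nu2Min : ℕ → ℝ := mval fun p e =>
  if p % 4 = 3 then -2*((ArithmeticFunction.moebius (p^(e-1)) : ℤ) : ℝ)
  else if p^e = 2 ∨ p^e = 4 then -1
  else if p^e = 8 then 1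
  else 0

def nu3Min : ℕ → ℝ := mval fun p e =>
  if p % 3 = 2 ∧ p^e ≠ 4 then -2*((ArithmeticFunction.moebius (p^(e-1)) : ℤ) : ℝ)
  else if p^e = 3 ∨ p^e = 9 then -1
  else if p^e = 4 ∨ p^e = 27 then 1
  else 0

/-- The Kronecker symbol `(−4|n)`, i.e. the nontrivial character mod 4. -/
def chi4 (n : ℕ) : ℝ := if n % 4 = 1 then 1 else if n % 4 = 3 then -1 else 0

/-- The Kronecker symbol `(−3|n)`, i.e. the nontrivial character mod 3. -/
def chi3 (n : ℕ) : ℝ := if n % 3 = 1 then 1 else if n % 3 = 2 then -1 else 0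

def c2 (k : ℕ) : ℝ := -(1/4) * chi4 (k-1)

def c3 (k : ℕ) : ℝ := -(1/3) * chi3 (k-1)

def delta2 (k : ℕ) : ℝ := if k = 2 then 1 else 0

def dFull (k N : ℕ) : ℝ :=
  ((k:ℝ)-1)/12 * psiFull N - 1/2 * nuInfFull N + c2 k * nu2Full N + c3 k * nu3Full N
    + delta2 k

def dNew (k N : ℕ) : ℝ :=
  ((k:ℝ)-1)/12 * psiNew N - 1/2 * nuInfNew N + c2 k * nu2New N + c3 k * nu3New N
    + delta2 k * ((ArithmeticFunction.moebius N : ℤ) : ℝ)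

def dMin (k N : ℕ) : ℝ :=
  ((k:ℝ)-1)/12 * psiMin N - 1/2 * nuInfMin N + c2 k * nu2Min N + c3 k * nu3Min N
    + delta2 k * ((ArithmeticFunction.moebius N : ℤ) : ℝ)

/-- `ω(N)`: the number of distinct prime divisors of `N`. -/
def omega (N : ℕ) : ℕ := N.primeFactors.card

/-- A positive integer is squarefull if `p² ∣ N` for every prime `p ∣ N`. -/
def Squarefull (n : ℕ) : Prop := ∀ p : ℕ, p.Prime → p ∣ n → p^2 ∣ n

/-- `H(N)`: the largest squarefull divisor of `N`. -/
def squarefullPart (N : ℕ) : ℕ := sSup {d : ℕ | d ∣ N ∧ Squarefull d}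

/-- `η = ζ(3/2)/ζ(3)`. -/
def eta : ℝ := (riemannZeta (3/2) / riemannZeta 3).re

/-- Ford's coefficients `a_n = (n+1)log(n+1) − n log n − 1`. -/
def fordA (n : ℕ) : ℝ := ((n:ℝ)+1)*Real.log ((n:ℝ)+1) - (n:ℝ)*Real.log n - 1


def loglog (x : ℝ) : ℝ := Real.log (Real.log x)

def logloglog (x : ℝ) : ℝ := Real.log (Real.log (Real.log x))

def loglogloglog (x : ℝ) : ℝ := Real.log (Real.log (Real.log (Real.log x)))

end

lemma aux_inj {c b c' b' : ℕ} (hc : c ≠ 0) (hc' : c' ≠ 0) (hb : Squarefree b)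
    (hb' : Squarefree b') (h : c^2*b = c'^2*b') : c = c' ∧ b = b' := by
  have key : c = c' := by
    refine Nat.eq_of_factorization_eq hc hc' fun p => ?_
    have h1 := congrArg (fun n => n.factorization p) h
    simp only [Nat.factorization_mul (pow_ne_zero 2 hc) hb.ne_zero,
      Nat.factorization_mul (pow_ne_zero 2 hc') hb'.ne_zero, Nat.factorization_pow,
      Finsupp.add_apply, Finsupp.smul_apply, smul_eq_mul] at h1
    have h2 := hb.natFactorization_le_one p
    have h3 := hb'.natFactorization_le_one p
    omega
  subst key
  exact ⟨rfl, Nat.eq_of_mul_eq_mul_left (by positivity) h⟩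

lemma aux_decomp {N : ℕ} (hN : N ≠ 0) (h : Squarefull N) :
    ∃ a b : ℕ, Squarefree b ∧ a^2*b^3 = N := by
  obtain ⟨b, c, hbc, hb⟩ := Nat.sq_mul_squarefree N
  have hd : b ∣ c := by
    rw [← Nat.prod_primeFactors_of_squarefree hb]
    refine Finset.prod_primes_dvd _ (fun p hp => (Nat.prime_of_mem_primeFactors hp).prime) ?_
    intro p hp
    have pp := Nat.prime_of_mem_primeFactors hp
    have pb := Nat.dvd_of_mem_primeFactors hp
    by_contra hpc
    have h1 : p^2 ∣ c^2*b := by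
      rw [hbc]
      exact h p pp (hbc ▸ pb.mul_left _)
    have h2 : Nat.Coprime (p^2) (c^2) := Nat.Coprime.pow 2 2 ((Nat.Prime.coprime_iff_not_dvd pp).2 hpc)
    have h3 : p^2 ∣ b := h2.dvd_of_dvd_mul_left h1
    have := hb p (by rwa [← sq])
    exact pp.one_lt.ne' (Nat.isUnit_iff.1 this)
  obtain ⟨a, rfl⟩ := hd
  exact ⟨a, b, hb, by rw [← hbc]; ring⟩

lemma aux_zeta (s : ℝ) (hs : 1 < s) :
    riemannZeta (s:ℂ) = ((∑' n : ℕ, 1 / (n:ℝ)^s : ℝ) : ℂ) := by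
  rw [zeta_eq_tsum_one_div_nat_cpow (by simpa using hs), Complex.ofReal_tsum]
  congr 1; ext n
  rw [Complex.ofReal_div, Complex.ofReal_cpow (by positivity)]
  simp

lemma aux_pow (c : ℕ) : ((c:ℝ)^2)^(3/2:ℝ) = (c:ℝ)^(3:ℝ) := by
  rw [← Real.rpow_natCast, ← Real.rpow_mul (by positivity)]
  norm_num

lemma aux_eta (B : Finset ℕ) (hB : ∀ b ∈ B, Squarefree b) :
    ∑ b ∈ B, 1 / (b:ℝ)^(3/2:ℝ) ≤ eta := by
  have hs1 : Summable fun n : ℕ => 1 / (n:ℝ)^(3/2:ℝ) :=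
    Real.summable_one_div_nat_rpow.2 (by norm_num)
  have hs3 : Summable fun n : ℕ => 1 / (n:ℝ)^(3:ℝ) :=
    Real.summable_one_div_nat_rpow.2 (by norm_num)
  have he : eta = (∑' n : ℕ, 1 / (n:ℝ)^(3/2:ℝ)) / (∑' n : ℕ, 1 / (n:ℝ)^(3:ℝ)) := by
    have h1 := aux_zeta (3/2) (by norm_num)
    have h2 := aux_zeta 3 (by norm_num)
    push_cast at h1 h2
    unfold eta
    rw [h1, h2]
    norm_cast
  have hpos : 0 < ∑' n : ℕ, 1 / (n:ℝ)^(3:ℝ) :=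
    hs3.tsum_pos (fun n => by positivity) 1 (by norm_num)
  rw [he, le_div_iff₀ hpos, ← tsum_mul_left]
  refine Real.tsum_le_of_sum_le (fun n => by positivity) fun C => ?_
  have h0 : ∑ c ∈ C, (∑ b ∈ B, 1 / (b:ℝ)^(3/2:ℝ)) * (1 / (c:ℝ)^(3:ℝ))
      = ∑ c ∈ C.filter (· ≠ 0), (∑ b ∈ B, 1 / (b:ℝ)^(3/2:ℝ)) * (1 / (c:ℝ)^(3:ℝ)) := by
    rw [Finset.sum_filter_of_ne]
    rintro c - hc rfl
    apply hc
    norm_num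
  rw [h0, ← Finset.mul_sum, mul_comm, Finset.sum_mul_sum, ← Finset.sum_product']
  have hinj : Set.InjOn (fun q : ℕ × ℕ => q.1^2*q.2) (C.filter (· ≠ 0) ×ˢ B : Finset (ℕ × ℕ)) := by
    rintro ⟨c, b⟩ h ⟨c', b'⟩ h' e
    simp only [Finset.coe_product, Set.mem_prod, Finset.mem_coe, Finset.mem_filter] at h h'
    obtain ⟨h1, h2⟩ := aux_inj h.1.2 h'.1.2 (hB _ h.2) (hB _ h'.2) e
    rw [h1, h2]
  calc _ = ∑ q ∈ C.filter (· ≠ 0) ×ˢ B, 1 / ((q.1^2*q.2 : ℕ):ℝ)^(3/2:ℝ) := by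
        refine Finset.sum_congr rfl fun q _ => ?_
        push_cast
        rw [Real.mul_rpow (by positivity) (by positivity), aux_pow, one_div_mul_one_div]
    _ = ∑ n ∈ (C.filter (· ≠ 0) ×ˢ B).image (fun q : ℕ × ℕ => q.1^2*q.2), 1 / (n:ℝ)^(3/2:ℝ) := by
        rw [Finset.sum_image hinj]
    _ ≤ _ := hs1.sum_le_tsum _ (fun n _ => by positivity)

lemma aux_inner (y : ℝ) (hy : 0 < y) (A : Finset ℕ) (hA : ∀ a ∈ A, y < a) :
    ∑ a ∈ A, ((a:ℝ)^2)⁻¹ ≤ 2 / y := by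
  calc ∑ a ∈ A, ((a:ℝ)^2)⁻¹ ≤ ∑ a ∈ Finset.Ioo ⌊y⌋₊ (A.sup id + 1), ((a:ℝ)^2)⁻¹ := by
        refine Finset.sum_le_sum_of_subset_of_nonneg ?_ (fun _ _ _ => by positivity)
        intro a ha
        rw [Finset.mem_Ioo]
        exact ⟨(Nat.floor_lt hy.le).2 (hA a ha), Nat.lt_succ_of_le (Finset.le_sup (f := id) ha)⟩
    _ ≤ 2 / ((⌊y⌋₊:ℝ) + 1) := sum_Ioo_inv_sq_le _ _
    _ ≤ 2 / y := by
        gcongr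
        exact (Nat.lt_floor_add_one y).le

theorem squarefull_tail_sum (x : ℝ) (hx : 1 ≤ x) :
    (∑' N : {N : ℕ // Squarefull N ∧ x < (N:ℝ)}, 1 / (N.1:ℝ)) ≤ 2 * eta / Real.sqrt x := by
  refine Real.tsum_le_of_sum_le (fun n => by positivity) fun U => ?_
  have hdec : ∀ N : {N : ℕ // Squarefull N ∧ x < (N:ℝ)}, ∃ q : ℕ × ℕ,
      Squarefree q.2 ∧ q.1^2*q.2^3 = N.1 := by
    rintro ⟨N, h1, h2⟩
    obtain ⟨a, b, h⟩ := aux_decomp (N := N) (by rintro rfl; norm_num at h2; linarith) h1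
    exact ⟨(a, b), h⟩
  choose q hq1 hq2 using hdec
  have hinj : Function.Injective q := fun N M h => by
    apply Subtype.ext; rw [← hq2, ← hq2, h]
  set V := U.image q with hV
  have hVp : ∀ v ∈ V, Squarefree v.2 ∧ x < ((v.1^2*v.2^3 : ℕ):ℝ) := by
    intro v hv
    obtain ⟨N, -, rfl⟩ := Finset.mem_image.1 hv
    exact ⟨hq1 N, by rw [hq2]; exact N.2.2⟩
  have hx0 : 0 < x := by linarith
  have e1 : ∑ N ∈ U, 1 / (N.1:ℝ) = ∑ v ∈ V, 1 / ((v.1^2*v.2^3 : ℕ):ℝ) := by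
    rw [hV, Finset.sum_image (fun _ _ _ _ h => hinj h)]
    exact Finset.sum_congr rfl fun N _ => by rw [hq2]
  rw [e1, ← Finset.sum_fiberwise_of_maps_to (t := V.image Prod.snd) (g := Prod.snd)
    (fun v hv => Finset.mem_image_of_mem _ hv)]
  have hB : ∀ b ∈ V.image Prod.snd, Squarefree b := by
    intro b hb
    obtain ⟨v, hv, rfl⟩ := Finset.mem_image.1 hb
    exact (hVp v hv).1
  calc _ ≤ ∑ b ∈ V.image Prod.snd, 2 / Real.sqrt x * (1 / (b:ℝ)^(3/2:ℝ)) := by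
        refine Finset.sum_le_sum fun b hb => ?_
        have hb0 : (0:ℝ) < b := by exact_mod_cast (hB b hb).ne_zero.bot_lt
        have hT : (0:ℝ) < (b:ℝ)^(3/2:ℝ) := by positivity
        have hT2 : ((b:ℝ)^(3/2:ℝ))^2 = (b:ℝ)^3 := by
          rw [← Real.rpow_natCast, ← Real.rpow_mul hb0.le, ← Real.rpow_natCast]
          norm_num
        generalize (b:ℝ)^(3/2:ℝ) = T at *
        have hS : 0 < Real.sqrt x := Real.sqrt_pos.2 hx0
        have hi := aux_inner (Real.sqrt x / T) (by positivity)
          ((V.filter (fun v => v.2 = b)).image Prod.fst) (by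
            intro a ha
            obtain ⟨v, hv, rfl⟩ := Finset.mem_image.1 ha
            obtain ⟨hw, rfl⟩ := Finset.mem_filter.1 hv
            have h := (hVp v hw).2
            push_cast at h
            rw [div_lt_iff₀ hT, Real.sqrt_lt' (by
              have : v.1 ≠ 0 := by rintro h0; rw [h0] at h; norm_num at h; linarith
              positivity), mul_pow, hT2]
            exact h)
        rw [Finset.sum_image (by
          rintro ⟨a, b1⟩ h1 ⟨a', b2⟩ h2 h
          simp only [Finset.coe_filter, Set.mem_ofPred_eq] at h1 h2 h
          rw [h, h1.2, h2.2])] at hi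
        calc _ = (∑ v ∈ V.filter (fun v => v.2 = b), ((v.1:ℝ)^2)⁻¹) * (1 / T^2) := by
              rw [Finset.sum_mul]
              refine Finset.sum_congr rfl fun v hv => ?_
              rw [← (Finset.mem_filter.1 hv).2] at hT2
              push_cast
              rw [← hT2, one_div, mul_inv, one_div]
          _ ≤ 2 / (Real.sqrt x / T) * (1 / T^2) := by gcongr
          _ = _ := by field_simp
    _ = 2 / Real.sqrt x * ∑ b ∈ V.image Prod.snd, (1 / (b:ℝ)^(3/2:ℝ)) := by rw [Finset.mul_sum]
    _ ≤ 2 / Real.sqrt x * eta := by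
        gcongr
        exact aux_eta _ hB
    _ = _ := by ring
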